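/- For every agent a ∈ A and every formula φ of L_∀, the following formulas are valid: (1) ∀_a φ → φ (reflexivity); (2) ∀_a φ → ∀_a ∀_a φ (transitivity); (3) ∃_a ∀_a φ → ∀_a ∃_a φ (Church–Rosser); (4) ∃_a ◇_a φ ↔ ◇_a ∃_a φ. -/

import Mathlib

/-- A Kripke model over agents `A` and propositional variables `P`. -/
structure KModel (A P : Type) where
  S : Type
  R : A → S → S → Prop
  V : P → S → Prop

/-- `Refines B M s N t`: there is a `B`-refinement from `M_s` to `N_t`. -/
def Refines {A P : Type} (B : Set A) (M : KModel A P) (s : M.S)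
    (N : KModel A P) (t : N.S) : Prop :=
  ∃ Z : M.S → N.S → Prop,
    Z s t ∧
    (∀ u v, Z u v → ∀ p, M.V p u ↔ N.V p v) ∧
    (∀ a : A, ∀ u v, Z u v → ∀ v', N.R a v v' → ∃ u', M.R a u u' ∧ Z u' v') ∧
    (∀ a : A, a ∉ B → ∀ u v, Z u v → ∀ u', M.R a u u' → ∃ v', N.R a v v' ∧ Z u' v')

/-- The language `L_∀` of refinement modal logic. -/
inductive RForm (A P : Type) : Type where
  | atom : P → RForm A P
  | neg : RForm A P → RForm A P
  | and : RForm A P → RForm A P → RForm A P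
  | box : A → RForm A P → RForm A P
  | rall : A → RForm A P → RForm A P

/-- Satisfaction for refinement modal logic. -/
def Sat {A P : Type} : (M : KModel A P) → M.S → RForm A P → Prop
  | M, s, .atom p => M.V p s
  | M, s, .neg φ => ¬ Sat M s φ
  | M, s, .and φ ψ => Sat M s φ ∧ Sat M s ψ
  | M, s, .box a φ => ∀ t, M.R a s t → Sat M t φ
  | M, s, .rall a φ => ∀ (N : KModel A P) (t : N.S), Refines {a} M s N t → Sat N t φ

/-- Material implication `φ → ψ`, as an abbreviation. -/
def fimp {A P : Type} (φ ψ : RForm A P) : RForm A P := .neg (.and φ (.neg ψ))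

/-- Biimplication `φ ↔ ψ`, as an abbreviation. -/
def fiff {A P : Type} (φ ψ : RForm A P) : RForm A P := .and (fimp φ ψ) (fimp ψ φ)

/-- `◇_a φ := ¬□_a ¬φ`. -/
def fdia {A P : Type} (a : A) (φ : RForm A P) : RForm A P := .neg (.box a (.neg φ))

/-- `∃_a φ := ¬∀_a ¬φ`. -/
def fex {A P : Type} (a : A) (φ : RForm A P) : RForm A P := .neg (.rall a (.neg φ))

/-- A formula is valid iff it is true at every pointed model. -/
def Valid {A P : Type} (φ : RForm A P) : Prop :=
  ∀ (M : KModel A P) (s : M.S), Sat M s φ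

namespace Refines

variable {A P : Type} {B C : Set A} {M N K : KModel A P} {s : M.S} {t : N.S} {u : K.S}

theorem refl (B : Set A) (M : KModel A P) (s : M.S) : Refines B M s M s := by
  refine ⟨Eq, rfl, ?_, ?_, ?_⟩
  · rintro u _ rfl p
    rfl
  · rintro b u _ rfl v' h
    exact ⟨v', h, rfl⟩
  · rintro b _ u _ rfl u' h
    exact ⟨u', h, rfl⟩

theorem trans (h₁ : Refines B M s N t) (h₂ : Refines B N t K u) : Refines B M s K u := by
  obtain ⟨Z, hZ, at₁, back₁, forth₁⟩ := h₁
  obtain ⟨W, hW, at₂, back₂, forth₂⟩ := h₂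
  refine ⟨fun x z => ∃ y, Z x y ∧ W y z, ⟨t, hZ, hW⟩, ?_, ?_, ?_⟩
  · rintro x z ⟨y, hxy, hyz⟩ p
    exact (at₁ x y hxy p).trans (at₂ y z hyz p)
  · rintro b x z ⟨y, hxy, hyz⟩ z' hz
    obtain ⟨y', hy, hyz'⟩ := back₂ b y z hyz z' hz
    obtain ⟨x', hx, hxy'⟩ := back₁ b x y hxy y' hy
    exact ⟨x', hx, y', hxy', hyz'⟩
  · rintro b hb x z ⟨y, hxy, hyz⟩ x' hx
    obtain ⟨y', hy, hxy'⟩ := forth₁ b hb x y hxy x' hx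
    obtain ⟨z', hz, hyz'⟩ := forth₂ b hb y z hyz y' hy
    exact ⟨z', hz, y', hxy', hyz'⟩

theorem mono (hBC : B ⊆ C) (h : Refines B M s N t) : Refines C M s N t := by
  obtain ⟨Z, hZ, hat, hback, hforth⟩ := h
  exact ⟨Z, hZ, hat, hback, fun b hb => hforth b fun hb' => hb (hBC hb')⟩

/-- A refinement that gives up no agent is a bisimulation, hence symmetric. -/
theorem symm_of_empty (h : Refines ∅ M s N t) : Refines ∅ N t M s := by
  obtain ⟨Z, hZ, hat, hback, hforth⟩ := h
  exact ⟨fun y x => Z x y, hZ, fun y x hxy p => (hat x y hxy p).symm,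
    fun b y x hxy => hforth b (Set.notMem_empty b) x y hxy,
    fun b _ y x hxy => hback b x y hxy⟩

end Refines

/-- Satisfaction is invariant under bisimulation. -/
theorem sat_iff_of_refines_empty {A P : Type} (φ : RForm A P) :
    ∀ {M N : KModel A P} {s : M.S} {t : N.S}, Refines ∅ M s N t → (Sat M s φ ↔ Sat N t φ) := by
  induction φ with
  | atom p =>
    rintro M N s t ⟨Z, hZ, hat, -, -⟩
    exact hat s t hZ p
  | neg φ ih =>
    intro M N s t h
    exact not_congr (ih h)
  | and φ ψ ih₁ ih₂ =>
    intro M N s t h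
    exact and_congr (ih₁ h) (ih₂ h)
  | box b φ ih =>
    rintro M N s t ⟨Z, hZ, hat, hback, hforth⟩
    constructor
    · intro hs t' ht
      obtain ⟨s', hs', hZ'⟩ := hback b s t hZ t' ht
      exact (ih ⟨Z, hZ', hat, hback, hforth⟩).1 (hs s' hs')
    · intro ht s' hs
      obtain ⟨t', ht', hZ'⟩ := hforth b (Set.notMem_empty b) s t hZ s' hs
      exact (ih ⟨Z, hZ', hat, hback, hforth⟩).2 (ht t' ht')
  | rall b φ ih =>
    intro M N s t h
    exact ⟨fun hs K u hu => hs K u ((h.mono (Set.empty_subset _)).trans hu),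
      fun ht K u hu => ht K u ((h.symm_of_empty.mono (Set.empty_subset _)).trans hu)⟩

namespace KModel

variable {A P : Type}

/-- The model obtained by deleting all arrows of agent `a`. -/
def deleteAgent (M : KModel A P) (a : A) : KModel A P where
  S := M.S
  R b s t := b ≠ a ∧ M.R b s t
  V := M.V

theorem refines_deleteAgent {a : A} {M N : KModel A P} {s : M.S} {t : N.S}
    (h : Refines {a} M s N t) : Refines {a} N t (M.deleteAgent a) s := by
  obtain ⟨Z, hZ, hat, hback, hforth⟩ := h
  refine ⟨fun y x => Z x y, hZ, fun y x hxy p => (hat x y hxy p).symm, ?_, ?_⟩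
  · rintro b y x hxy x' ⟨hb, hx⟩
    exact hforth b hb x y hxy x' hx
  · intro b hb y x hxy y' hy
    obtain ⟨x', hx, hxy'⟩ := hback b x y hxy y' hy
    exact ⟨x', ⟨hb, hx⟩, hxy'⟩

/-- Arrows of `KModel.graft`. -/
inductive GraftRel (a : A) (M : KModel A P) (s : M.S) (N : KModel A P) (t : N.S) :
    A → Option (M.S ⊕ N.S) → Option (M.S ⊕ N.S) → Prop
  | left {b x x'} : M.R b x x' → GraftRel a M s N t b (some (.inl x)) (some (.inl x'))
  | right {b y y'} : N.R b y y' → GraftRel a M s N t b (some (.inr y)) (some (.inr y'))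
  | root {b x} : b ≠ a → M.R b s x → GraftRel a M s N t b none (some (.inl x))
  | new : GraftRel a M s N t a none (some (.inr t))

/-- The disjoint union of `M` and `N` with a new root, a copy of `s` whose only `a`-arrow
leads to `t`. -/
def graft (a : A) (M : KModel A P) (s : M.S) (N : KModel A P) (t : N.S) : KModel A P where
  S := Option (M.S ⊕ N.S)
  R := GraftRel a M s N t
  V p x := x.elim (M.V p s) (Sum.elim (M.V p) (N.V p))

variable {a : A} {M N : KModel A P} {s : M.S} {t : N.S}

theorem refines_graft_inr (y : N.S) :
    Refines ∅ N y (graft a M s N t) (some (.inr y)) := by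
  refine ⟨fun y z => z = some (.inr y), rfl, ?_, ?_, ?_⟩
  · rintro y _ rfl p
    rfl
  · rintro b y _ rfl _ (_ | h)
    exact ⟨_, h, rfl⟩
  · rintro b - y _ rfl y' h
    exact ⟨_, .right h, rfl⟩

theorem refines_graft_root {s' : M.S} (hs : M.R a s s') (h : Refines {a} M s' N t) :
    Refines {a} M s (graft a M s N t) none := by
  obtain ⟨Z, hZ, hat, hback, hforth⟩ := h
  refine ⟨fun x z => z.elim (x = s) (Sum.elim (x = ·) (Z x)), rfl, ?_, ?_, ?_⟩
  · rintro x (_ | z | y) hx p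
    · obtain rfl : x = s := hx
      rfl
    · obtain rfl : x = z := hx
      rfl
    · exact hat x y hx p
  · rintro b x z hx z' (hR | hR | ⟨hb, hR⟩ | _)
    · obtain rfl := hx
      exact ⟨_, hR, rfl⟩
    · exact hback b x _ hx _ hR
    · obtain rfl := hx
      exact ⟨_, hR, rfl⟩
    · obtain rfl := hx
      exact ⟨s', hs, hZ⟩
  · rintro b hb x (_ | z | y) hx x' hR
    · obtain rfl : x = s := hx
      exact ⟨_, .root hb hR, rfl⟩
    · obtain rfl : x = z := hx
      exact ⟨_, .left hR, rfl⟩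
    · obtain ⟨y', hy, hxy⟩ := hforth b hb x y hx x' hR
      exact ⟨_, .right hy, hxy⟩

end KModel

section Semantics

variable {A P : Type} {M : KModel A P} {s : M.S}

theorem sat_fimp {φ ψ : RForm A P} : Sat M s (fimp φ ψ) ↔ (Sat M s φ → Sat M s ψ) := by
  simp [fimp, Sat]

theorem sat_fiff {φ ψ : RForm A P} : Sat M s (fiff φ ψ) ↔ (Sat M s φ ↔ Sat M s ψ) :=
  (and_congr sat_fimp sat_fimp).trans iff_def.symm

theorem sat_fdia {a : A} {φ : RForm A P} :
    Sat M s (fdia a φ) ↔ ∃ t, M.R a s t ∧ Sat M t φ := by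
  simp [fdia, Sat]

theorem sat_fex {a : A} {φ : RForm A P} :
    Sat M s (fex a φ) ↔ ∃ (N : KModel A P) (t : N.S), Refines {a} M s N t ∧ Sat N t φ := by
  simp [fex, Sat]

end Semantics

/-- Validities of RML: reflexivity, transitivity, Church–Rosser, and the
commutation of `∃_a` with `◇_a`. -/
theorem rall_validities {A P : Type} (a : A) (φ : RForm A P) :
    Valid (fimp (.rall a φ) φ) ∧
    Valid (fimp (.rall a φ) (.rall a (.rall a φ))) ∧
    Valid (fimp (fex a (.rall a φ)) (.rall a (fex a φ))) ∧
    Valid (fiff (fex a (fdia a φ)) (fdia a (fex a φ))) := by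
  refine ⟨fun M s => sat_fimp.2 fun h => h M s (.refl _ M s),
    fun M s => sat_fimp.2 fun h N t hN K u hK => h K u (hN.trans hK),
    fun M s => sat_fimp.2 fun h K u hK => ?_, fun M s => sat_fiff.2 ?_⟩
  · obtain ⟨N, t, hN, hφ⟩ := sat_fex.1 h
    exact sat_fex.2 ⟨M.deleteAgent a, s, KModel.refines_deleteAgent hK,
      hφ _ _ (KModel.refines_deleteAgent hN)⟩
  · simp only [sat_fex, sat_fdia]
    constructor
    · rintro ⟨N, t, ⟨Z, hZ, hat, hback, hforth⟩, t', ht, hφ⟩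
      obtain ⟨s', hs, hZ'⟩ := hback a s t hZ t' ht
      exact ⟨s', hs, N, t', ⟨Z, hZ', hat, hback, hforth⟩, hφ⟩
    · rintro ⟨s', hs, N, t, h, hφ⟩
      exact ⟨KModel.graft a M s N t, none, KModel.refines_graft_root hs h, some (.inr t), .new,
        (sat_iff_of_refines_empty φ (KModel.refines_graft_inr t)).1 hφ⟩
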